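/- arXiv:0804.1188 — 2 statements merged into one kernel-verified Lean document; each statement's English description precedes it below -/
import Mathlib

section
/- Let (C,V,J) be a J²C-module. Then V decomposes as an orthogonal direct sum of submodules of the form Cv_j: there exists an orthonormal set {v₁,…,v_n} in V such that V = Cv₁ ⊕ ⋯ ⊕ Cv_n orthogonally. -/
open scoped RealInnerProductSpace

theorem stmt9 {C V : Type*} [NormedAddCommGroup C] [InnerProductSpace ℝ C]
    [FiniteDimensional ℝ C] [NormedAddCommGroup V] [InnerProductSpace ℝ V]
    [FiniteDimensional ℝ V]
    (e : C) (he : ‖e‖ = 1) (J : C →ₗ[ℝ] V →ₗ[ℝ] V)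
    (hJ1 : ∀ v : V, J e v = v)
    (hJnorm : ∀ (ζ : C) (v : V), ‖J ζ v‖ = ‖ζ‖ * ‖v‖)
    (hJ2 : ∀ (v : V) (ζ η : C), ∃ ξ : C, J ζ (J η v) = J ξ v) :
    ∃ (n : ℕ) (v : Fin n → V), Orthonormal ℝ v ∧
      (∀ i j : Fin n, i ≠ j → ∀ ζ η : C, ⟪J ζ (v i), J η (v j)⟫ = 0) ∧
      (∀ w : V, w ∈ Submodule.span ℝ (⋃ i, Set.range fun ζ : C => J ζ (v i))) := by
  by_contra hcon
  push Not at hcon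
  have key : ∀ (ζ : C) (v w : V), ⟪J ζ v, w⟫ + ⟪v, J ζ w⟫ = 2 * ⟪ζ, e⟫ * ⟪v, w⟫ := by
    intro ζ v w
    have sq : ∀ (η : C) (x : V), ⟪J η x, J η x⟫ = ⟪η, η⟫ * ⟪x, x⟫ := by
      intro η x
      simp only [real_inner_self_eq_norm_sq, hJnorm]
      ring
    have hee : ⟪e, e⟫ = (1 : ℝ) := by
      rw [real_inner_self_eq_norm_sq, he]; norm_num
    have h1 := sq (ζ + e) (v + w)
    have h2 := sq (ζ + e) v
    have h3 := sq (ζ + e) w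
    have h4 := sq ζ (v + w)
    have h5 := sq ζ v
    have h6 := sq ζ w
    simp only [map_add, LinearMap.add_apply, hJ1, inner_add_left, inner_add_right, hee,
      real_inner_comm ζ e, real_inner_comm v w] at h1 h2 h3 h4 h5 h6
    have c1 := real_inner_comm (J ζ v) w
    have c2 := real_inner_comm (J ζ w) v
    have c3 := real_inner_comm v w
    have c4 := real_inner_comm ζ e
    have c5 := real_inner_comm (J ζ v) v
    have c6 := real_inner_comm (J ζ w) w
    have c7 := real_inner_comm (J ζ w) (J ζ v)
    simp only [c1, c2, c3, c4, c5, c6, c7] at *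
    linarith
  have all : ∀ n : ℕ, ∃ v : Fin n → V, Orthonormal ℝ v ∧
      (∀ i j : Fin n, i ≠ j → ∀ ζ η : C, ⟪J ζ (v i), J η (v j)⟫ = 0) := by
    intro n
    induction n with
    | zero => exact ⟨fun i => i.elim0, ⟨fun i => i.elim0, fun i => i.elim0⟩, fun i => i.elim0⟩
    | succ n ih =>
      obtain ⟨v, hv, ho⟩ := ih
      obtain ⟨w, hw⟩ := hcon n v hv ho
      set S := Submodule.span ℝ (⋃ i, Set.range fun ζ : C => J ζ (v i)) with hS
      have hmem : ∀ i ζ, J ζ (v i) ∈ S := fun i ζ =>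
        Submodule.subset_span (Set.mem_iUnion.2 ⟨i, ζ, rfl⟩)
      have hinv : ∀ ζ, ∀ x ∈ S, J ζ x ∈ S := by
        intro ζ
        have : S ≤ S.comap (J ζ) := by
          rw [hS, Submodule.span_le, ← hS]
          intro x hx
          obtain ⟨i, η, rfl⟩ := Set.mem_iUnion.1 hx
          obtain ⟨ξ, hξ⟩ := hJ2 (v i) ζ η
          change J ζ (J η (v i)) ∈ S
          rw [hξ]
          exact hmem i ξ
        exact fun x hx => this hx
      have hinv' : ∀ ζ, ∀ x ∈ Sᗮ, J ζ x ∈ Sᗮ := by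
        intro ζ x hx
        rw [Submodule.mem_orthogonal] at hx ⊢
        intro y hy
        have := key ζ y x
        rw [hx y hy, hx _ (hinv ζ y hy)] at this
        linarith
      have hne : Sᗮ ≠ ⊥ := by
        intro h
        rw [Submodule.orthogonal_eq_bot_iff] at h
        exact hw (h ▸ Submodule.mem_top)
      obtain ⟨x, hx, hx0⟩ := Submodule.exists_mem_ne_zero_of_ne_bot hne
      obtain ⟨u, hu, hu1⟩ : ∃ u ∈ Sᗮ, ‖u‖ = 1 :=
        ⟨(‖x‖⁻¹ : ℝ) • x, Sᗮ.smul_mem _ hx, by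
          rw [norm_smul, norm_inv, norm_norm, inv_mul_cancel₀ (norm_ne_zero_iff.2 hx0)]⟩
      have hop : ∀ i j : Fin (n + 1), i ≠ j → ∀ ζ η : C,
          ⟪J ζ ((Fin.cons u v : Fin (n + 1) → V) i),
            J η ((Fin.cons u v : Fin (n + 1) → V) j)⟫ = 0 := by
        intro i j hij ζ η
        induction i using Fin.cases with
        | zero =>
          induction j using Fin.cases with
          | zero => exact absurd rfl hij
          | succ j =>
            simp only [Fin.cons_zero, Fin.cons_succ]
            exact Submodule.inner_left_of_mem_orthogonal (hmem j η) (hinv' ζ u hu)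
        | succ i =>
          induction j using Fin.cases with
          | zero =>
            simp only [Fin.cons_zero, Fin.cons_succ]
            exact Submodule.inner_right_of_mem_orthogonal (hmem i ζ) (hinv' η u hu)
          | succ j =>
            simp only [Fin.cons_succ]
            exact ho i j (fun h => hij (h ▸ rfl)) ζ η
      refine ⟨Fin.cons u v, ⟨?_, ?_⟩, hop⟩
      · intro i
        induction i using Fin.cases with
        | zero => simpa using hu1
        | succ i => simpa using hv.1 i
      · intro i j hij
        have := hop i j hij e e
        rwa [hJ1, hJ1] at this
  obtain ⟨v, hv, -⟩ := all (Module.finrank ℝ V + 1)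
  have := hv.linearIndependent.fintype_card_le_finrank
  rw [Fintype.card_fin] at this
  omega
end

section
/- Let (C,V,J) be a J²C-module, W = C ⊕ V with the Riemannian metric on W given by ⟨X,Y⟩_w = ⟨X,Y⟩/(1+|w|²)² for X,Y ∈ Cw, ⟨X,Y⟩_w = ⟨X,Y⟩/(1+|w|²) for X,Y ⊥ Cw, and Cw ⊥ (Cw)^⊥ in this metric. Then for any plane E in the tangent space at 0 with orthonormal basis X, Y, the sectional curvature of E equals 1 + 3|π_{CX}Y|², where π_{CX} is the orthogonal projection onto the C-line CX. -/
open scoped RealInnerProductSpace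

section helpers

variable {C V : Type*} [NormedAddCommGroup C] [InnerProductSpace ℝ C]
    [NormedAddCommGroup V] [InnerProductSpace ℝ V]

lemma pol1 (J : C →ₗ[ℝ] V →ₗ[ℝ] V)
    (hJnorm : ∀ (ζ : C) (v : V), ‖J ζ v‖ = ‖ζ‖ * ‖v‖) (x : C) (p q : V) :
    ⟪J x p, J x q⟫ = ‖x‖ ^ 2 * ⟪p, q⟫ := by
  have h1 := hJnorm x (p + q)
  have h2 : ‖J x (p + q)‖ ^ 2 = (‖x‖ * ‖p + q‖) ^ 2 := by rw [h1]
  rw [map_add, mul_pow, norm_add_sq_real, norm_add_sq_real, hJnorm, hJnorm] at h2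
  linarith

lemma pol2 (J : C →ₗ[ℝ] V →ₗ[ℝ] V)
    (hJnorm : ∀ (ζ : C) (v : V), ‖J ζ v‖ = ‖ζ‖ * ‖v‖) (x y : C) (p q : V) :
    ⟪J x p, J y q⟫ + ⟪J y p, J x q⟫ = 2 * ⟪x, y⟫ * ⟪p, q⟫ := by
  have h := pol1 J hJnorm (x + y) p q
  have hx := pol1 J hJnorm x p q
  have hy := pol1 J hJnorm y p q
  simp only [map_add, LinearMap.add_apply, inner_add_left, inner_add_right,
    norm_add_sq_real] at h
  linarith

/-- conjugation on `C` -/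
noncomputable def cj (e x : C) : C := (2 * ⟪x, e⟫) • e - x

lemma cj_inner (e : C) (he : ‖e‖ = 1) (x y : C) : ⟪cj e x, cj e y⟫ = ⟪x, y⟫ := by
  have h : ⟪e, e⟫ = 1 := by rw [real_inner_self_eq_norm_sq, he]; norm_num
  simp only [cj, inner_sub_left, inner_sub_right, real_inner_smul_left, real_inner_smul_right, h,
    real_inner_comm e y, real_inner_comm e x]
  ring

lemma cj_norm (e : C) (he : ‖e‖ = 1) (x : C) : ‖cj e x‖ = ‖x‖ := by
  have h := cj_inner e he x x
  rw [real_inner_self_eq_norm_sq, real_inner_self_eq_norm_sq] at h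
  exact (sq_eq_sq₀ (norm_nonneg _) (norm_nonneg _)).1 h

lemma cj_cj (e : C) (he : ‖e‖ = 1) (x : C) : cj e (cj e x) = x := by
  have h : ⟪e, e⟫ = 1 := by rw [real_inner_self_eq_norm_sq, he]; norm_num
  have h2 : ⟪cj e x, e⟫ = ⟪x, e⟫ := by
    simp only [cj, inner_sub_left, real_inner_smul_left, h]; ring
  unfold cj at h2 ⊢
  rw [h2]; abel

lemma cj_add (e x y : C) : cj e (x + y) = cj e x + cj e y := by
  simp only [cj, inner_add_left]; module

lemma cj_smul (e : C) (t : ℝ) (x : C) : cj e (t • x) = t • cj e x := by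
  simp only [cj, real_inner_smul_left]; module

lemma J_adj (e : C) (J : C →ₗ[ℝ] V →ₗ[ℝ] V) (hJ1 : ∀ v : V, J e v = v)
    (hJnorm : ∀ (ζ : C) (v : V), ‖J ζ v‖ = ‖ζ‖ * ‖v‖) (x : C) (p q : V) :
    ⟪J (cj e x) p, q⟫ = ⟪p, J x q⟫ := by
  have h := pol2 J hJnorm x e p q
  rw [hJ1, hJ1] at h
  simp only [cj, map_sub, map_smul, LinearMap.sub_apply, LinearMap.smul_apply, hJ1,
    inner_sub_left, real_inner_smul_left]
  linarith

lemma J_cj_J (e : C) (J : C →ₗ[ℝ] V →ₗ[ℝ] V) (hJ1 : ∀ v : V, J e v = v)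
    (hJnorm : ∀ (ζ : C) (v : V), ‖J ζ v‖ = ‖ζ‖ * ‖v‖) (x : C) (p : V) :
    J (cj e x) (J x p) = ‖x‖ ^ 2 • p := by
  refine ext_inner_right ℝ fun q => ?_
  rw [J_adj e J hJ1 hJnorm, pol1 J hJnorm, real_inner_smul_left]

lemma J_J_cj (e : C) (he : ‖e‖ = 1) (J : C →ₗ[ℝ] V →ₗ[ℝ] V) (hJ1 : ∀ v : V, J e v = v)
    (hJnorm : ∀ (ζ : C) (v : V), ‖J ζ v‖ = ‖ζ‖ * ‖v‖) (x : C) (p : V) :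
    J x (J (cj e x) p) = ‖x‖ ^ 2 • p := by
  have h := J_cj_J e J hJ1 hJnorm (cj e x) p
  rwa [cj_cj e he, cj_norm e he] at h

variable [FiniteDimensional ℝ C] [FiniteDimensional ℝ V]

/-- the transpose of `ζ ↦ J ζ b` -/
noncomputable def PP (J : C →ₗ[ℝ] V →ₗ[ℝ] V) (b d : V) : C := LinearMap.adjoint (J.flip b) d

lemma PP_inner (J : C →ₗ[ℝ] V →ₗ[ℝ] V) (b d : V) (ζ : C) : ⟪PP J b d, ζ⟫ = ⟪d, J ζ b⟫ := by
  unfold PP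
  rw [LinearMap.adjoint_inner_left]; rfl

lemma PP_norm_le (J : C →ₗ[ℝ] V →ₗ[ℝ] V)
    (hJnorm : ∀ (ζ : C) (v : V), ‖J ζ v‖ = ‖ζ‖ * ‖v‖)
    (hJ2 : ∀ (v : V) (ζ η : C), ∃ ξ : C, J ζ (J η v) = J ξ v) (a : C) (u d : V) :
    ‖PP J (J a u) d‖ ≤ ‖a‖ * ‖PP J u d‖ := by
  by_cases hu : u = 0
  · subst hu
    have : PP J (J a 0) d = 0 := by simp [PP]
    rw [this, norm_zero]; positivity
  set z := PP J (J a u) d with hz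
  obtain ⟨ξ, hξ⟩ := hJ2 u z a
  have hn : ‖ξ‖ = ‖z‖ * ‖a‖ := by
    have h := hJnorm z (J a u)
    rw [hξ, hJnorm, hJnorm, ← mul_assoc] at h
    exact mul_right_cancel₀ (norm_ne_zero_iff.2 hu) h
  have h1 : ‖z‖ ^ 2 = ⟪PP J u d, ξ⟫ := by
    rw [PP_inner, ← hξ, ← PP_inner, ← hz, real_inner_self_eq_norm_sq]
  have h2 := real_inner_le_norm (PP J u d) ξ
  rw [← h1, hn] at h2
  by_cases h0 : ‖z‖ = 0
  · rw [h0]; positivity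
  have h3 : 0 < ‖z‖ := lt_of_le_of_ne (norm_nonneg _) (Ne.symm h0)
  refine le_of_mul_le_mul_left ?_ h3
  nlinarith

lemma PP_norm (e : C) (he : ‖e‖ = 1) (J : C →ₗ[ℝ] V →ₗ[ℝ] V) (hJ1 : ∀ v : V, J e v = v)
    (hJnorm : ∀ (ζ : C) (v : V), ‖J ζ v‖ = ‖ζ‖ * ‖v‖)
    (hJ2 : ∀ (v : V) (ζ η : C), ∃ ξ : C, J ζ (J η v) = J ξ v) (a : C) (u d : V) :
    ‖PP J (J a u) d‖ = ‖a‖ * ‖PP J u d‖ := by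
  refine le_antisymm (PP_norm_le J hJnorm hJ2 a u d) ?_
  have h := PP_norm_le J hJnorm hJ2 (cj e a) (J a u) d
  rw [J_cj_J e J hJ1 hJnorm, cj_norm e he] at h
  have h2 : PP J (‖a‖ ^ 2 • u) d = ‖a‖ ^ 2 • PP J u d := by
    simp [PP]
  rw [h2, norm_smul, Real.norm_of_nonneg (by positivity)] at h
  by_cases h0 : ‖a‖ = 0
  · rw [h0]; simp
  have h3 : 0 < ‖a‖ := lt_of_le_of_ne (norm_nonneg _) (Ne.symm h0)
  refine le_of_mul_le_mul_left ?_ h3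
  nlinarith

/-- `|w|² |π_{Cw} T|²` -/
noncomputable def GG (e : C) (J : C →ₗ[ℝ] V →ₗ[ℝ] V) (w T : C × V) : ℝ :=
  ‖w.1‖ ^ 2 * ‖T.1‖ ^ 2 + 2 * ⟪J (cj e T.1) T.2, J (cj e w.1) w.2⟫ + ‖PP J w.2 T.2‖ ^ 2

lemma GG_smul (e : C) (J : C →ₗ[ℝ] V →ₗ[ℝ] V) (w T : C × V) (t : ℝ) :
    GG e J (t • w) (t • T) = t ^ 4 * GG e J w T := by
  have h2 : PP J (t • w.2) (t • T.2) = (t * t) • PP J w.2 T.2 := by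
    simp [PP, smul_smul]
  simp only [GG, Prod.smul_fst, Prod.smul_snd, h2, cj_smul, map_smul, LinearMap.smul_apply,
    real_inner_smul_left, real_inner_smul_right, norm_smul, mul_pow, Real.norm_eq_abs, sq_abs,
    abs_mul]
  ring

lemma GG_rot (e : C) (he : ‖e‖ = 1) (J : C →ₗ[ℝ] V →ₗ[ℝ] V) (hJ1 : ∀ v : V, J e v = v)
    (hJnorm : ∀ (ζ : C) (v : V), ‖J ζ v‖ = ‖ζ‖ * ‖v‖) (X Y : C × V)
    (hX : ⟪X.1, X.1⟫ + ⟪X.2, X.2⟫ = 1) (hY : ⟪Y.1, Y.1⟫ + ⟪Y.2, Y.2⟫ = 1)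
    (hXY : ⟪X.1, Y.1⟫ + ⟪X.2, Y.2⟫ = 0) (c s : ℝ) (hcs : c ^ 2 + s ^ 2 = 1) :
    GG e J (c • X + s • Y) (-s • X + c • Y) = GG e J X Y := by
  obtain ⟨a, b⟩ := X
  obtain ⟨x, y⟩ := Y
  simp only at hX hY hXY
  have he1 : ⟪e, e⟫ = 1 := by rw [real_inner_self_eq_norm_sq, he]; norm_num
  -- the alternating part
  have hPsym : ∀ p q : V, PP J p q + PP J q p = (2 * ⟪p, q⟫) • e := by
    intro p q
    refine ext_inner_right ℝ fun ζ => ?_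
    have h := pol2 J hJnorm ζ e p q
    rw [hJ1, hJ1] at h
    rw [inner_add_left, PP_inner, PP_inner, real_inner_smul_left, real_inner_comm ζ e,
      real_inner_comm (J ζ p) q]
    linarith
  have hPself : ∀ p : V, PP J p p = ⟪p, p⟫ • e := by
    intro p
    have h := hPsym p p
    have h2 : (2 : ℝ) • PP J p p = (2 : ℝ) • (⟪p, p⟫ • e) := by
      rw [two_smul, h, smul_smul]
    exact smul_right_injective C (two_ne_zero (α := ℝ)) h2
  have hPe : ⟪PP J b y, e⟫ = ⟪b, y⟫ := by rw [PP_inner, hJ1, real_inner_comm]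
  have hyb : PP J y b = (2 * ⟪b, y⟫) • e - PP J b y := by
    rw [← hPsym b y]; abel
  have hP : PP J (c • b + s • y) (-s • b + c • y)
      = PP J b y + (-(c * s) * ⟪b, b⟫ + c * s * ⟪y, y⟫ - 2 * s ^ 2 * ⟪b, y⟫) • e := by
    have : PP J (c • b + s • y) (-s • b + c • y) = (-(c * s)) • PP J b b + (c ^ 2) • PP J b y
        + (-(s ^ 2)) • PP J y b + (c * s) • PP J y y := by
      simp only [PP, map_add, map_smul, LinearMap.add_apply, LinearMap.smul_apply]
      module
    rw [this, hPself, hPself, hyb]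
    have hc : c ^ 2 = 1 - s ^ 2 := by linarith
    rw [hc]
    module
  have hPn : ‖PP J (c • b + s • y) (-s • b + c • y)‖ ^ 2 = ‖PP J b y‖ ^ 2
      + 2 * (-(c * s) * ⟪b, b⟫ + c * s * ⟪y, y⟫ - 2 * s ^ 2 * ⟪b, y⟫) * ⟪b, y⟫
      + (-(c * s) * ⟪b, b⟫ + c * s * ⟪y, y⟫ - 2 * s ^ 2 * ⟪b, y⟫) ^ 2 := by
    rw [hP, norm_add_sq_real, real_inner_smul_right, hPe, norm_smul, he, mul_one,
      Real.norm_eq_abs, sq_abs]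
    ring
  -- the mixed term
  have k1 := pol2 J hJnorm (cj e a) (cj e x) b y
  have k2 := pol1 J hJnorm (cj e a) b y
  have k3 := pol1 J hJnorm (cj e x) b y
  have k4 := pol2 J hJnorm (cj e a) (cj e x) b b
  have k5 := pol2 J hJnorm (cj e a) (cj e x) y y
  have k6 := pol1 J hJnorm (cj e a) b b
  have k7 := pol1 J hJnorm (cj e x) y y
  have k8 := pol1 J hJnorm (cj e a) y y
  have k9 := pol1 J hJnorm (cj e x) b b
  simp only [cj_inner e he, cj_norm e he, ← real_inner_self_eq_norm_sq] at k1 k2 k3 k4 k5 k6 k7 k8 k9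
  simp only [GG, Prod.smul_mk, Prod.mk_add_mk, hPn, cj_add, cj_smul, map_add, map_smul,
    LinearMap.add_apply, LinearMap.smul_apply]
  simp only [← real_inner_self_eq_norm_sq, inner_add_left, inner_add_right, real_inner_smul_left,
    real_inner_smul_right]
  have s1 : ⟪x, a⟫ = ⟪a, x⟫ := real_inner_comm _ _
  have s3 : ⟪J (cj e a) y, J (cj e a) b⟫ = ⟪J (cj e a) b, J (cj e a) y⟫ := real_inner_comm _ _
  have s4 : ⟪J (cj e x) b, J (cj e a) b⟫ = ⟪J (cj e a) b, J (cj e x) b⟫ := real_inner_comm _ _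
  have s5 : ⟪J (cj e x) b, J (cj e a) y⟫ = ⟪J (cj e a) y, J (cj e x) b⟫ := real_inner_comm _ _
  have s6 : ⟪J (cj e x) y, J (cj e a) b⟫ = ⟪J (cj e a) b, J (cj e x) y⟫ := real_inner_comm _ _
  have s7 : ⟪J (cj e x) y, J (cj e a) y⟫ = ⟪J (cj e a) y, J (cj e x) y⟫ := real_inner_comm _ _
  have s8 : ⟪J (cj e x) y, J (cj e x) b⟫ = ⟪J (cj e x) b, J (cj e x) y⟫ := real_inner_comm _ _
  simp only [s1, s3, s4, s5, s6, s7, s8] at k1 k2 k3 k4 k5 k6 k7 k8 k9 ⊢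
  have k1' : ⟪J (cj e a) y, J (cj e x) b⟫
      = 2 * ⟪a, x⟫ * ⟪b, y⟫ - ⟪J (cj e a) b, J (cj e x) y⟫ := by linarith
  have k4' : ⟪J (cj e a) b, J (cj e x) b⟫ = ⟪a, x⟫ * ⟪b, b⟫ := by linarith
  have k5' : ⟪J (cj e a) y, J (cj e x) y⟫ = ⟪a, x⟫ * ⟪y, y⟫ := by linarith
  have hb : ⟪b, b⟫ = 1 - ⟪a, a⟫ := by linarith
  have hy : ⟪y, y⟫ = 1 - ⟪x, x⟫ := by linarith
  have hby : ⟪b, y⟫ = -⟪a, x⟫ := by linarith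
  simp only [k1', k2, k3, k4', k5', k6, k7, k8, k9]
  simp only [hb, hy, hby]
  generalize ⟪J (cj e a) b, J (cj e x) y⟫ = m
  generalize ⟪PP J b y, PP J b y⟫ = n
  generalize ⟪a, a⟫ = A
  generalize ⟪a, x⟫ = B
  generalize ⟪x, x⟫ = D
  linear_combination (-2 * (-(c * s) * (1 - A) + c * s * (1 - D) - 2 * s ^ 2 * (-B)) * (-B)
    + (A * D + 2 * m) * (c ^ 2 + s ^ 2 + 1)) * hcs

lemma lim_sin : Filter.Tendsto (fun ρ : ℝ => (ρ - Real.sin ρ) / ρ ^ 3)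
    (nhdsWithin 0 (Set.Ioi 0)) (nhds (1 / 6)) := by
  have h0 : Filter.Tendsto (fun ρ : ℝ => ρ * (5 / 96)) (nhdsWithin 0 (Set.Ioi 0)) (nhds 0) := by
    have : Filter.Tendsto (fun ρ : ℝ => ρ * (5 / 96)) (nhds 0) (nhds (0 * (5 / 96))) :=
      (Continuous.tendsto (by fun_prop) 0)
    rw [zero_mul] at this
    exact this.mono_left nhdsWithin_le_nhds
  rw [tendsto_iff_dist_tendsto_zero]
  refine squeeze_zero' (Filter.Eventually.of_forall fun _ => dist_nonneg) ?_ h0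
  have h1 : ∀ᶠ ρ : ℝ in nhdsWithin 0 (Set.Ioi 0), ρ ∈ Set.Ioo (0 : ℝ) 1 :=
    Ioo_mem_nhdsGT one_pos
  filter_upwards [h1] with ρ hρ
  have hp : 0 < ρ := hρ.1
  have hb := Real.sin_bound (x := ρ) (by rw [abs_of_pos hp]; exact hρ.2.le)
  rw [abs_of_pos hp] at hb
  rw [Real.dist_eq]
  have : (ρ - Real.sin ρ) / ρ ^ 3 - 1 / 6 = -(Real.sin ρ - (ρ - ρ ^ 3 / 6)) / ρ ^ 3 := by
    field_simp; ring
  rw [this, abs_div, abs_neg, abs_of_pos (pow_pos hp 3), div_le_iff₀ (pow_pos hp 3)]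
  nlinarith [pow_pos hp 4, mul_lt_mul_of_pos_left hρ.2 (pow_pos hp 4)]

lemma lim_aux (κ : ℝ) (hκ : κ ≤ 1) :
    Filter.Tendsto (fun ρ : ℝ => (ρ - Real.sin ρ * √(1 - κ * Real.sin ρ ^ 2)) / ρ ^ 3)
    (nhdsWithin 0 (Set.Ioi 0)) (nhds (1 / 6 + κ / 2)) := by
  have hs : Filter.Tendsto (fun ρ : ℝ => Real.sin ρ / ρ) (nhdsWithin 0 (Set.Ioi 0)) (nhds 1) := by
    have h := (Real.hasDerivAt_sin 0).tendsto_slope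
    have h2 := h.mono_left (nhdsWithin_mono 0 (fun x (hx : (0 : ℝ) < x) => ne_of_gt hx))
    rw [Real.cos_zero] at h2
    refine h2.congr fun x => ?_
    simp [slope_def_field]
  have hq : Filter.Tendsto (fun ρ : ℝ => κ / (1 + √(1 - κ * Real.sin ρ ^ 2)))
      (nhdsWithin 0 (Set.Ioi 0)) (nhds (κ / 2)) := by
    have hc : Continuous (fun ρ : ℝ => κ / (1 + √(1 - κ * Real.sin ρ ^ 2))) := by
      refine Continuous.div continuous_const (by fun_prop) fun x => ?_
      positivity
    have h := hc.tendsto 0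
    have e : κ / (1 + √(1 - κ * Real.sin 0 ^ 2)) = κ / 2 := by
      simp; norm_num
    rw [e] at h
    exact h.mono_left nhdsWithin_le_nhds
  have h := lim_sin.add ((hs.pow 3).mul hq)
  rw [one_pow, one_mul] at h
  refine h.congr' ?_
  filter_upwards [self_mem_nhdsWithin] with ρ hρ
  have hp : ρ ≠ 0 := ne_of_gt hρ
  have hnn : 0 ≤ 1 - κ * Real.sin ρ ^ 2 := by
    nlinarith [Real.sin_sq_add_cos_sq ρ, sq_nonneg (Real.sin ρ), sq_nonneg (Real.cos ρ)]
  have hsq := Real.sq_sqrt hnn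
  have hpos : 1 + √(1 - κ * Real.sin ρ ^ 2) ≠ 0 := by positivity
  generalize √(1 - κ * Real.sin ρ ^ 2) = S at *
  field_simp
  linear_combination Real.sin ρ * hsq

end helpers

theorem stmt18 {C V : Type*} [NormedAddCommGroup C] [InnerProductSpace ℝ C]
    [FiniteDimensional ℝ C] [NormedAddCommGroup V] [InnerProductSpace ℝ V]
    [FiniteDimensional ℝ V]
    (e : C) (he : ‖e‖ = 1) (J : C →ₗ[ℝ] V →ₗ[ℝ] V)
    (hJ1 : ∀ v : V, J e v = v)
    (hJnorm : ∀ (ζ : C) (v : V), ‖J ζ v‖ = ‖ζ‖ * ‖v‖)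
    (hJ2 : ∀ (v : V) (ζ η : C), ∃ ξ : C, J ζ (J η v) = J ξ v)
    (r : C × V → C × V → Prop)
    (hr : ∀ p q : C × V, r p q ↔
      ((p.1 = 0 ∧ q.1 = 0 ∧ ∃ ξ : C, p.2 = J ξ q.2) ∨
       (p.1 ≠ 0 ∧ q.1 ≠ 0 ∧
         J ((‖p.1‖ ^ 2)⁻¹ • ((2 * ⟪p.1, e⟫) • e - p.1)) p.2 =
           J ((‖q.1‖ ^ 2)⁻¹ • ((2 * ⟪q.1, e⟫) • e - q.1)) q.2)))
    -- the product inner product on W = C ⊕ V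
    (innW : (C × V) → (C × V) → ℝ)
    (hinnW : ∀ p q : C × V, innW p q = ⟪p.1, q.1⟫ + ⟪p.2, q.2⟫)
    -- orthogonal projection onto the C-line through w
    (proj : (C × V) → (C × V) → (C × V))
    (hprojMem : ∀ w : C × V, w ≠ 0 → ∀ T : C × V, proj w T = 0 ∨ r (proj w T) w)
    (hprojOrth : ∀ w : C × V, w ≠ 0 → ∀ T q : C × V, r q w →
      innW (T - proj w T) q = 0)
    -- a plane in the tangent space at the origin with orthonormal basis X, Y
    (X Y : C × V) (hX : innW X X = 1) (hY : innW Y Y = 1) (hXY : innW X Y = 0)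
    -- the squared metric norm of a tangent vector T at a point w ≠ 0
    (mn : (C × V) → (C × V) → ℝ)
    (hmn : ∀ w T : C × V, mn w T =
      innW (proj w T) (proj w T) / (1 + innW w w) ^ 2 +
        innW (T - proj w T) (T - proj w T) / (1 + innW w w))
    -- the length of the exponential image of the circle of radius ρ in the plane
    (L : ℝ → ℝ)
    (hL : ∀ ρ : ℝ, L ρ = ∫ θ in (0 : ℝ)..(2 * Real.pi),
      Real.sqrt (mn (Real.tan ρ • (Real.cos θ • X + Real.sin θ • Y))
        (Real.tan ρ • (-(Real.sin θ) • X + Real.cos θ • Y)))) :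
    Filter.Tendsto (fun ρ : ℝ => (3 / Real.pi) * ((2 * Real.pi * ρ - L ρ) / ρ ^ 3))
      (nhdsWithin 0 (Set.Ioi 0))
      (nhds (1 + 3 * innW (proj X Y) (proj X Y))) := by
  have hself : ∀ p : C × V, innW p p = ‖p.1‖ ^ 2 + ‖p.2‖ ^ 2 := fun p => by
    rw [hinnW, real_inner_self_eq_norm_sq, real_inner_self_eq_norm_sq]
  have hcj : ∀ x : C, (2 * ⟪x, e⟫) • e - x = cj e x := fun _ => rfl
  simp only [hcj] at hr
  -- the squared length of the projection
  have key : ∀ w : C × V, w ≠ 0 → ∀ T : C × V,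
      innW (proj w T) (proj w T) * innW w w = GG e J w T := by
    intro w hw T
    have hmem := hprojMem w hw T
    have horth := hprojOrth w hw T
    set p := proj w T with hp
    by_cases ha : w.1 = 0
    · have hb : w.2 ≠ 0 := fun h => hw (Prod.ext ha h)
      obtain ⟨hp1, ξ, hp2⟩ : p.1 = 0 ∧ ∃ ξ : C, p.2 = J ξ w.2 := by
        rcases hmem with h | h
        · exact ⟨by rw [h]; rfl, 0, by rw [h]; simp⟩
        · rcases (hr _ _).1 h with h | h
          · exact ⟨h.1, h.2.2⟩
          · exact absurd ha h.2.1
      have hP : PP J w.2 T.2 = ‖w.2‖ ^ 2 • ξ := by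
        refine ext_inner_right ℝ fun ζ => ?_
        have h := horth (0, J ζ w.2) ((hr _ _).2 (Or.inl ⟨rfl, ha, ζ, rfl⟩))
        have h2 := pol2 J hJnorm ξ ζ w.2 w.2
        rw [real_inner_comm (J ξ w.2) (J ζ w.2), real_inner_self_eq_norm_sq] at h2
        rw [hinnW] at h
        simp only [inner_zero_right, Prod.snd_sub, hp2, inner_sub_left] at h
        rw [PP_inner, real_inner_smul_left]
        linarith
      rw [hself, hself, GG, hP, hp1, hp2, ha, hJnorm, norm_smul,
        Real.norm_of_nonneg (by positivity)]
      simp [cj]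
      ring
    · have hn : ‖w.1‖ ≠ 0 := norm_ne_zero_iff.2 ha
      set u : V := J ((‖w.1‖ ^ 2)⁻¹ • cj e w.1) w.2 with hu
      have hJu : ∀ (x : C) (v : V), x ≠ 0 → J x (J ((‖x‖ ^ 2)⁻¹ • cj e x) v) = v := by
        intro x v hx
        have hx' : ‖x‖ ≠ 0 := norm_ne_zero_iff.2 hx
        rw [map_smul, LinearMap.smul_apply, map_smul, J_J_cj e he J hJ1 hJnorm, smul_smul,
          inv_mul_cancel₀ (pow_ne_zero 2 hx'), one_smul]
      have hJu' : ∀ (x : C) (v : V), x ≠ 0 → J ((‖x‖ ^ 2)⁻¹ • cj e x) (J x v) = v := by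
        intro x v hx
        have hx' : ‖x‖ ≠ 0 := norm_ne_zero_iff.2 hx
        rw [map_smul, LinearMap.smul_apply, J_cj_J e J hJ1 hJnorm, smul_smul,
          inv_mul_cancel₀ (pow_ne_zero 2 hx'), one_smul]
      have hw2 : w.2 = J w.1 u := (hJu _ _ ha).symm
      have hp2 : p.2 = J p.1 u := by
        rcases hmem with h | h
        · rw [h]; simp
        · rcases (hr _ _).1 h with h | h
          · exact absurd h.2.1 ha
          · rw [hu, ← h.2.2, hJu _ _ h.1]
      have hP : T.1 + PP J u T.2 = (1 + ‖u‖ ^ 2) • p.1 := by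
        refine ext_inner_right ℝ fun ζ => ?_
        by_cases hζ : ζ = 0
        · simp [hζ]
        have h := horth (ζ, J ζ u) ((hr _ _).2 (Or.inr ⟨hζ, ha, hJu' _ _ hζ⟩))
        have h2 := pol2 J hJnorm p.1 ζ u u
        rw [real_inner_comm (J p.1 u) (J ζ u), real_inner_self_eq_norm_sq] at h2
        rw [hinnW] at h
        simp only [Prod.fst_sub, Prod.snd_sub, hp2, inner_sub_left] at h
        rw [inner_add_left, PP_inner, real_inner_smul_left]
        linarith
      have hPn : ‖T.1‖ ^ 2 + 2 * ⟪T.2, J T.1 u⟫ + ‖PP J u T.2‖ ^ 2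
          = (1 + ‖u‖ ^ 2) ^ 2 * ‖p.1‖ ^ 2 := by
        have h : ‖T.1 + PP J u T.2‖ ^ 2 = ‖(1 + ‖u‖ ^ 2) • p.1‖ ^ 2 := by rw [hP]
        rw [norm_add_sq_real, real_inner_comm, PP_inner, norm_smul,
          Real.norm_of_nonneg (by positivity)] at h
        rw [h]; ring
      have hmix : ⟪J (cj e T.1) T.2, J (cj e w.1) w.2⟫ = ‖w.1‖ ^ 2 * ⟪T.2, J T.1 u⟫ := by
        rw [J_adj e J hJ1 hJnorm, hw2, J_cj_J e J hJ1 hJnorm, map_smul, real_inner_smul_right]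
      rw [hself, hself, GG, hmix, hp2]
      rw [show PP J w.2 T.2 = PP J (J w.1 u) T.2 by rw [← hw2],
        PP_norm e he J hJ1 hJnorm hJ2, show ‖w.2‖ = ‖w.1‖ * ‖u‖ by rw [hw2, hJnorm], hJnorm]
      linear_combination (-‖w.1‖ ^ 2) * hPn
  -- Pythagoras
  have pyth : ∀ w : C × V, w ≠ 0 → ∀ T : C × V,
      innW (T - proj w T) (T - proj w T) = innW T T - innW (proj w T) (proj w T) := by
    intro w hw T
    have h : innW (T - proj w T) (proj w T) = 0 := by
      rcases hprojMem w hw T with h | h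
      · rw [h, hinnW]; simp
      · exact hprojOrth w hw T _ h
    simp only [hinnW, Prod.fst_sub, Prod.snd_sub, inner_sub_left, inner_sub_right] at h ⊢
    have c1 := real_inner_comm T.1 (proj w T).1
    have c2 := real_inner_comm T.2 (proj w T).2
    linarith
  have hX0 : X ≠ 0 := by
    rintro rfl
    rw [hinnW] at hX; simp at hX
  have hκ : innW (proj X Y) (proj X Y) = GG e J X Y := by
    have h := key X hX0 Y
    rwa [hX, mul_one] at h
  have hκ1 : GG e J X Y ≤ 1 := by
    have h := pyth X hX0 Y
    have h2 : 0 ≤ innW (Y - proj X Y) (Y - proj X Y) := by rw [hself]; positivity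
    rw [hκ, hY] at h
    linarith
  rw [hκ]
  set κ := GG e J X Y with hκdef
  have hX' := hX
  have hY' := hY
  have hXY' := hXY
  rw [hinnW] at hX' hY' hXY'
  have hrot : ∀ c s t : ℝ, c ^ 2 + s ^ 2 = 1 →
      innW (t • (c • X + s • Y)) (t • (c • X + s • Y)) = t ^ 2 := by
    intro c s t hcs
    rw [hinnW]
    simp only [Prod.smul_fst, Prod.smul_snd, Prod.fst_add, Prod.snd_add, inner_add_left,
      inner_add_right, real_inner_smul_left, real_inner_smul_right, real_inner_comm X.1 Y.1,
      real_inner_comm X.2 Y.2]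
    linear_combination t ^ 2 * c ^ 2 * hX' + t ^ 2 * s ^ 2 * hY' + 2 * t ^ 2 * c * s * hXY'
      + t ^ 2 * hcs
  have hmn2 : ∀ t θ : ℝ, t ≠ 0 → mn (t • (Real.cos θ • X + Real.sin θ • Y))
        (t • (-(Real.sin θ) • X + Real.cos θ • Y))
      = t ^ 2 * κ / (1 + t ^ 2) ^ 2 + t ^ 2 * (1 - κ) / (1 + t ^ 2) := by
    intro t θ ht
    have hcs : Real.cos θ ^ 2 + Real.sin θ ^ 2 = 1 := Real.cos_sq_add_sin_sq θ
    have hw := hrot _ _ t hcs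
    have hT := hrot (-(Real.sin θ)) (Real.cos θ) t (by rw [← hcs]; ring)
    have hw0 : t • (Real.cos θ • X + Real.sin θ • Y) ≠ 0 := by
      intro h
      rw [h, hinnW] at hw
      simp at hw
      exact pow_ne_zero 2 ht hw.symm
    have hk := key _ hw0 (t • (-(Real.sin θ) • X + Real.cos θ • Y))
    rw [hw, GG_smul, GG_rot e he J hJ1 hJnorm X Y hX' hY' hXY' _ _ hcs, ← hκdef] at hk
    have hk2 : innW (proj (t • (Real.cos θ • X + Real.sin θ • Y))
        (t • (-(Real.sin θ) • X + Real.cos θ • Y))) (proj (t • (Real.cos θ • X + Real.sin θ • Y))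
        (t • (-(Real.sin θ) • X + Real.cos θ • Y))) = t ^ 2 * κ := by
      refine mul_right_cancel₀ (pow_ne_zero 2 ht) ?_
      rw [hk]; ring
    rw [hmn, pyth _ hw0, hk2, hT, hw]
    ring
  have hlim := (lim_aux κ hκ1).const_mul 6
  rw [show 6 * (1 / 6 + κ / 2) = 1 + 3 * κ by ring] at hlim
  refine hlim.congr' ?_
  have h1 : ∀ᶠ ρ : ℝ in nhdsWithin 0 (Set.Ioi 0), ρ ∈ Set.Ioo (0 : ℝ) (Real.pi / 2) :=
    Ioo_mem_nhdsGT (by positivity)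
  filter_upwards [h1] with ρ hρ
  have hρ0 : 0 < ρ := hρ.1
  have hsin : 0 < Real.sin ρ := Real.sin_pos_of_pos_of_lt_pi hρ0 (by linarith [hρ.2, Real.pi_pos])
  have hcos : 0 < Real.cos ρ := Real.cos_pos_of_mem_Ioo ⟨by linarith [Real.pi_pos], hρ.2⟩
  have htan : Real.tan ρ ≠ 0 := (Real.tan_pos_of_pos_of_lt_pi_div_two hρ0 hρ.2).ne'
  have h2 : Real.tan ρ ^ 2 * κ / (1 + Real.tan ρ ^ 2) ^ 2
      + Real.tan ρ ^ 2 * (1 - κ) / (1 + Real.tan ρ ^ 2)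
      = Real.sin ρ ^ 2 * (1 - κ * Real.sin ρ ^ 2) := by
    have h3 : 1 + Real.tan ρ ^ 2 = (Real.cos ρ ^ 2)⁻¹ := by
      rw [Real.tan_eq_sin_div_cos]
      field_simp
      linarith [Real.sin_sq_add_cos_sq ρ]
    rw [h3, Real.tan_eq_sin_div_cos]
    field_simp
    linear_combination κ * Real.sin_sq_add_cos_sq ρ
  have hLρ : L ρ = 2 * Real.pi * (Real.sin ρ * √(1 - κ * Real.sin ρ ^ 2)) := by
    rw [hL]
    simp only [hmn2 _ _ htan, h2]
    rw [Real.sqrt_mul (by positivity), Real.sqrt_sq hsin.le, intervalIntegral.integral_const]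
    simp
  rw [hLρ]
  have := Real.pi_pos.ne'
  field_simp
  ring
end
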